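/- Let k be a field of characteristic different from 2, and let A = {a_1,…,a_{p−1}} and B = {b_1,…,b_{p+1}} be subsets of {1,…,n} with A ⊄ B. Then the quadratic form P_{A,B} on ⋀^p k^n has rank 2·|B ∖ A|; that is, the symmetric bilinear form Q(ω,η) = P_{A,B}(ω+η) − P_{A,B}(ω) − P_{A,B}(η) has rank 2·|B ∖ A| as a linear map ⋀^p k^n → (⋀^p k^n)^*. -/

import Mathlib

open ExteriorAlgebra

noncomputable section

variable (k : Type*) [Field k]

/-- The alternating map giving the coordinate `Π_idx` (antisymmetric in `idx`). -/
def coordA {n : ℕ} (q : ℕ) (idx : Fin q → Fin n) :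
    (Fin n → k) [⋀^Fin q]→ₗ[k] k :=
  (Matrix.detRowAlternating : (Fin q → k) [⋀^Fin q]→ₗ[k] k).compLinearMap
    (LinearMap.funLeft k k idx)

/-- The coordinate functional `Π_idx` on the exterior algebra. -/
def coordF {n : ℕ} (q : ℕ) (idx : Fin q → Fin n) :
    ExteriorAlgebra k (Fin n → k) →ₗ[k] k :=
  ExteriorAlgebra.liftAlternating
    (Function.update (fun i => (0 : (Fin n → k) [⋀^Fin i]→ₗ[k] k)) q (coordA k q idx))

/-- Decomposability of an element of the exterior algebra, in degree `q`. -/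
def IsDecomp {n : ℕ} (q : ℕ) (x : ExteriorAlgebra k (Fin n → k)) : Prop :=
  ∃ v : Fin q → (Fin n → k), x = ExteriorAlgebra.ιMulti k q v

/-- The dual isomorphism `δ` on the degree-`p` part, with values in degree `n-p`. -/
def dualAt (n p : ℕ) (ω : ExteriorAlgebra k (Fin n → k)) :
    ExteriorAlgebra k (Fin n → k) :=
  ∑ s : {s : Finset (Fin n) // s.card = p},
    coordF k p (fun a => (s.1.orderIsoOfFin s.2 a : Fin n)) ω •
      ExteriorAlgebra.ιMulti k (n - p)
        (fun a => Pi.single (((s.1ᶜ).orderIsoOfFin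
          (by rw [Finset.card_compl, s.2, Fintype.card_fin]) a : Fin n)) (1 : k))

/-- The index tuple `(α_i, α_j, β_1^{ε_1}, …, β_m^{ε_m}, γ_1, …, γ_c)`. -/
def tupleP {n : ℕ} (m c : ℕ) (α : Fin 4 → Fin n) (β : Fin m → Fin 2 → Fin n)
    (γ : Fin c → Fin n) (i j : Fin 4) (ε : Fin m → Fin 2) : Fin (2 + (m + c)) → Fin n :=
  Fin.append ![α i, α j] (Fin.append (fun l => β l (ε l)) γ)

/-- The functional `π_{ij} = Π_{α_i α_j β⃗_1 … β⃗_m γ_1 … γ_c}`. -/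
def piF {n : ℕ} (m c : ℕ) (α : Fin 4 → Fin n) (β : Fin m → Fin 2 → Fin n)
    (γ : Fin c → Fin n) (i j : Fin 4) :
    ExteriorAlgebra k (Fin n → k) →ₗ[k] k :=
  ∑ ε : Fin m → Fin 2, coordF k (2 + (m + c)) (tupleP m c α β γ i j ε)

/-- The rank 6 quadratic form `P'_{A,B,C}`. -/
def Pprime {n : ℕ} (m c : ℕ) (α : Fin 4 → Fin n) (β : Fin m → Fin 2 → Fin n)
    (γ : Fin c → Fin n) (ω : ExteriorAlgebra k (Fin n → k)) : k :=
  piF k m c α β γ 0 1 ω * piF k m c α β γ 2 3 ω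
    - piF k m c α β γ 0 2 ω * piF k m c α β γ 1 3 ω
    + piF k m c α β γ 0 3 ω * piF k m c α β γ 1 2 ω

/-- The ordering/distinctness conditions on the triple `(A,B,C)`. -/
def OrderedABC {n : ℕ} (m c : ℕ) (α : Fin 4 → Fin n) (β : Fin m → Fin 2 → Fin n)
    (γ : Fin c → Fin n) : Prop :=
  Function.Injective (Sum.elim α (Sum.elim (fun x : Fin m × Fin 2 => β x.1 x.2) γ)) ∧
    StrictMono α ∧ (∀ l, β l 0 < β l 1) ∧
    (∀ ν : Fin 2, StrictMono fun l => β l ν) ∧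
    (∀ l, β l 0 < α 0) ∧ (∀ l, β l 1 < α 2) ∧ StrictMono γ

/-- The set `S' = A ∪ B_1 ∪ C`. -/
def SP {n : ℕ} (m c : ℕ) (α : Fin 4 → Fin n) (β : Fin m → Fin 2 → Fin n)
    (γ : Fin c → Fin n) : Finset (Fin n) :=
  Finset.univ.image α ∪ Finset.univ.image (fun l => β l 1) ∪ Finset.univ.image γ

open Classical in
/-- The matrix of the map `X_{A,B,C} : k^n → k^{p+2}`. -/
def Xmat (p : ℕ) {n : ℕ} (m c : ℕ) (α : Fin 4 → Fin n) (β : Fin m → Fin 2 → Fin n)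
    (γ : Fin c → Fin n) : Matrix (Fin (p + 2)) (Fin n) k :=
  if h : (SP m c α β γ).card = p + 2 then
    fun j i =>
      (if i = ((SP m c α β γ).orderIsoOfFin h j : Fin n) then 1 else 0) +
        ∑ l : Fin m,
          if i = β l 0 ∧ β l 1 = ((SP m c α β γ).orderIsoOfFin h j : Fin n) then 1 else 0
  else 0

/-- The linear map `X_{A,B,C} : k^n → k^{p+2}`. -/
def XL (p : ℕ) {n : ℕ} (m c : ℕ) (α : Fin 4 → Fin n) (β : Fin m → Fin 2 → Fin n)
    (γ : Fin c → Fin n) : (Fin n → k) →ₗ[k] (Fin (p + 2) → k) :=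
  (Xmat k p m c α β γ).mulVecLin

open Classical in
/-- The matrix of the map `Z : k^{p+2} → k^4`. -/
def Zmat (p : ℕ) {n : ℕ} (m c : ℕ) (α : Fin 4 → Fin n) (β : Fin m → Fin 2 → Fin n)
    (γ : Fin c → Fin n) : Matrix (Fin 4) (Fin (p + 2)) k :=
  fun j i => if XL k p m c α β γ (Pi.single (α j) 1) = Pi.single i 1 then 1 else 0

/-- The linear map `Z : k^{p+2} → k^4`. -/
def ZL (p : ℕ) {n : ℕ} (m c : ℕ) (α : Fin 4 → Fin n) (β : Fin m → Fin 2 → Fin n)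
    (γ : Fin c → Fin n) : (Fin (p + 2) → k) →ₗ[k] (Fin 4 → k) :=
  (Zmat k p m c α β γ).mulVecLin

/-- The Grassmann cone preserving map `G_{A,B,C} = ⋀²Z ∘ δ ∘ ⋀^p X_{A,B,C}`. -/
def GABC (p : ℕ) {n : ℕ} (m c : ℕ) (α : Fin 4 → Fin n) (β : Fin m → Fin 2 → Fin n)
    (γ : Fin c → Fin n) (ω : ExteriorAlgebra k (Fin n → k)) :
    ExteriorAlgebra k (Fin 4 → k) :=
  ExteriorAlgebra.map (ZL k p m c α β γ)
    (dualAt k (p + 2) p (ExteriorAlgebra.map (XL k p m c α β γ) ω))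

/-- The general Plücker quadratic form `P_{A,B}` for index sequences
`a : Fin d → Fin n` and `b : Fin (e+1) → Fin n`. -/
def Pluecker {n : ℕ} (d e : ℕ) (a : Fin d → Fin n) (b : Fin (e + 1) → Fin n)
    (ω : ExteriorAlgebra k (Fin n → k)) : k :=
  ∑ i : Fin (e + 1), (-1 : k) ^ (i : ℕ) *
    (coordF k (d + 1) (Fin.snoc a (b i)) ω * coordF k e (fun j => b (i.succAbove j)) ω)


/-- The coordinate functional restricted to the exterior power submodule. -/
def coordOn (k : Type*) [Field k] {n : ℕ} (q : ℕ) (idx : Fin q → Fin n) :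
    (⋀[k]^q (Fin n → k)) →ₗ[k] k :=
  (coordF k q idx).comp (Submodule.subtype _)

/-- The polarization `Q(ω,η) = P_{A,B}(ω+η) − P_{A,B}(ω) − P_{A,B}(η)` of the Plücker
quadratic form `P_{A,B}`, as a linear map into the dual space. -/
def pluBil (k : Type*) [Field k] {n : ℕ} (d : ℕ)
    (a : Fin d → Fin n) (b : Fin (d + 2) → Fin n) :
    (⋀[k]^(d + 1) (Fin n → k)) →ₗ[k] ((⋀[k]^(d + 1) (Fin n → k)) →ₗ[k] k) :=
  ∑ i : Fin (d + 2), ((-1 : k) ^ (i : ℕ)) •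
    ((coordOn k (d + 1) (Fin.snoc a (b i))).smulRight
        (coordOn k (d + 1) fun j => b (i.succAbove j)) +
      (coordOn k (d + 1) fun j => b (i.succAbove j)).smulRight
        (coordOn k (d + 1) (Fin.snoc a (b i))))

lemma coordOn_ιMulti {k : Type*} [Field k] {n q : ℕ} (idx : Fin q → Fin n)
    (w : Fin q → Fin n → k) :
    coordOn k q idx (exteriorPower.ιMulti k q w) = (Matrix.of fun r c => w r (idx c)).det := by
  simp only [coordOn, coordF, LinearMap.comp_apply, Submodule.subtype_apply,
    exteriorPower.ιMulti_apply_coe, ExteriorAlgebra.liftAlternating_apply_ιMulti,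
    Function.update_self]
  rfl

/-- The wedge product of the standard basis vectors indexed by `idx`. -/
def basisWedge (k : Type*) [Field k] {n q : ℕ} (idx : Fin q → Fin n) : ⋀[k]^q (Fin n → k) :=
  exteriorPower.ιMulti k q fun r => Pi.single (idx r) 1

section coordinates

variable {k : Type*} [Field k] {n q : ℕ}

lemma coordOn_basisWedge_self {idx : Fin q → Fin n} (h : Function.Injective idx) :
    coordOn k q idx (basisWedge k idx) = 1 := by
  rw [basisWedge, coordOn_ιMulti, ← Matrix.det_one (n := Fin q)]
  congr 1
  ext r c
  simp [Matrix.one_apply, Pi.single_apply, h.eq_iff, eq_comm]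

lemma coordOn_basisWedge_of_notMem_range {idx idx' : Fin q → Fin n} (c : Fin q)
    (h : idx c ∉ Set.range idx') : coordOn k q idx (basisWedge k idx') = 0 := by
  rw [basisWedge, coordOn_ιMulti]
  refine Matrix.det_eq_zero_of_column_eq_zero c fun r => ?_
  exact Pi.single_eq_of_ne (fun e => h ⟨r, e.symm⟩) _

lemma coordOn_basisWedge_of_notMem_range' {idx idx' : Fin q → Fin n} (r : Fin q)
    (h : idx' r ∉ Set.range idx) : coordOn k q idx (basisWedge k idx') = 0 := by
  rw [basisWedge, coordOn_ιMulti]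
  refine Matrix.det_eq_zero_of_row_eq_zero r fun c => ?_
  exact Pi.single_eq_of_ne (fun e => h ⟨c, e⟩) _

lemma coordOn_eq_zero_of_eq {idx : Fin q → Fin n} {c c' : Fin q} (hne : c ≠ c')
    (h : idx c = idx c') : coordOn k q idx = 0 := by
  apply exteriorPower.linearMap_ext
  ext w
  simp only [LinearMap.compAlternatingMap_apply, coordOn_ιMulti, LinearMap.zero_apply]
  exact Matrix.det_zero_of_column_eq hne fun r => by simp [h]

end coordinates

/-- A sum of hyperbolic planes built from `f i`, `g i` admitting dual vectors `u i`, `v i` has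
rank twice the number of planes. -/
lemma finrank_range_sum_hyperbolic {k V J : Type*} [Field k] [AddCommGroup V] [Module k V]
    [Fintype J] [DecidableEq J] (f g : J → V →ₗ[k] k) (u v : J → V) (c : J → k)
    (hc : ∀ i, c i ≠ 0)
    (hfu : ∀ i j, f i (u j) = if i = j then 1 else 0)
    (hgv : ∀ i j, g i (v j) = if i = j then 1 else 0)
    (hfv : ∀ i j, f i (v j) = 0) (hgu : ∀ i j, g i (u j) = 0) :
    Module.finrank k (LinearMap.range
      (∑ i, c i • ((f i).smulRight (g i) + (g i).smulRight (f i)))) = 2 * Fintype.card J := by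
  set T := ∑ i, c i • ((f i).smulRight (g i) + (g i).smulRight (f i)) with hT
  have hT_apply (x : V) : T x = ∑ i, c i • (f i x • g i + g i x • f i) := by
    simp [hT, LinearMap.sum_apply]
  have hTu (j : J) : T (u j) = c j • g j := by
    simp [hT_apply, hfu, hgu]
  have hTv (j : J) : T (v j) = c j • f j := by
    simp [hT_apply, hfv, hgv]
  have hli : LinearIndependent k (Sum.elim f g) := by
    rw [Fintype.linearIndependent_iff]
    intro t ht
    rw [Fintype.sum_sum_type] at ht
    rintro (j | j)
    · simpa [hfu, hgu, LinearMap.sum_apply] using LinearMap.congr_fun ht (u j)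
    · simpa [hfv, hgv, LinearMap.sum_apply] using LinearMap.congr_fun ht (v j)
  have hrange : LinearMap.range T = Submodule.span k (Set.range (Sum.elim f g)) := by
    apply le_antisymm
    · rintro _ ⟨x, rfl⟩
      rw [hT_apply]
      refine Submodule.sum_mem _ fun i _ => Submodule.smul_mem _ _ (Submodule.add_mem _ ?_ ?_)
      · exact Submodule.smul_mem _ _ (Submodule.subset_span ⟨Sum.inr i, rfl⟩)
      · exact Submodule.smul_mem _ _ (Submodule.subset_span ⟨Sum.inl i, rfl⟩)
    · rw [Submodule.span_le]
      rintro _ ⟨j | j, rfl⟩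
      · exact ⟨(c j)⁻¹ • v j, by simp [hTv, smul_smul, hc]⟩
      · exact ⟨(c j)⁻¹ • u j, by simp [hTu, smul_smul, hc]⟩
  rw [hrange, finrank_span_eq_card hli, Fintype.card_sum, two_mul]

/-- For `char k ≠ 2`, subsets `A` (of size `p-1 = d`) and `B` (of size
`p+1 = d+2`) of `{1,…,n}` with `A ⊄ B`, the Plücker quadratic form `P_{A,B}` has rank
`2 · |B ∖ A|`. -/
theorem pluecker_rank
    {k : Type*} [Field k] (h2 : (2 : k) ≠ 0) {n d : ℕ}
    (a : Fin d → Fin n) (b : Fin (d + 2) → Fin n)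
    (ha : StrictMono a) (hb : StrictMono b)
    (hAB : ¬ Set.range a ⊆ Set.range b) :
    Module.finrank k ↥(LinearMap.range (pluBil k d a b)) =
      2 * (Finset.univ.image b \ Finset.univ.image a).card := by
  classical
  obtain ⟨_, ⟨s, rfl⟩, hs⟩ := Set.not_subset.mp hAB
  let J := {i : Fin (d + 2) // b i ∉ Set.range a}
  have hmem (i j : Fin (d + 2)) (hij : i ≠ j) : b j ∈ Set.range fun l => b (i.succAbove l) := by
    obtain ⟨l, rfl⟩ := Fin.exists_succAbove_eq hij.symm
    exact ⟨l, rfl⟩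
  have hs' (i : Fin (d + 2)) : a s ∉ Set.range fun l => b (i.succAbove l) := by
    rintro ⟨l, hl⟩
    exact hs ⟨_, hl⟩
  have hsum : pluBil k d a b = ∑ i : J, ((-1 : k) ^ (i.1 : ℕ)) •
      ((coordOn k (d + 1) (Fin.snoc a (b i.1))).smulRight
          (coordOn k (d + 1) fun j => b (i.1.succAbove j)) +
        (coordOn k (d + 1) fun j => b (i.1.succAbove j)).smulRight
          (coordOn k (d + 1) (Fin.snoc a (b i.1)))) := by
    rw [pluBil, ← Fintype.sum_subtype_add_sum_subtype (fun i => b i ∉ Set.range a)]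
    refine (congrArg (_ + ·) (Finset.sum_eq_zero fun i _ => ?_)).trans (add_zero _)
    obtain ⟨l, hl⟩ := not_not.mp i.2
    have hzero : coordOn k (d + 1) (Fin.snoc a (b i.1)) = 0 :=
      coordOn_eq_zero_of_eq l.castSucc_ne_last (by rw [Fin.snoc_castSucc, Fin.snoc_last, hl])
    rw [hzero]
    ext
    simp
  have hcard : Fintype.card J = (Finset.univ.image b \ Finset.univ.image a).card := by
    rw [Fintype.card_subtype, ← Finset.card_image_of_injective _ hb.injective]
    congr 1
    ext x
    simp only [Finset.mem_image, Finset.mem_filter, Finset.mem_univ, true_and, Finset.mem_sdiff,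
      Set.mem_range]
    constructor
    · rintro ⟨i, hi, rfl⟩
      exact ⟨⟨i, rfl⟩, hi⟩
    · rintro ⟨⟨i, rfl⟩, hi⟩
      exact ⟨i, hi, rfl⟩
  rw [hsum, ← hcard]
  refine finrank_range_sum_hyperbolic _ _ (fun i : J => basisWedge k (Fin.snoc a (b i.1)))
    (fun i : J => basisWedge k fun j => b (i.1.succAbove j)) _
    (fun i => pow_ne_zero _ (neg_ne_zero.mpr one_ne_zero)) ?_ ?_ ?_ ?_
  · intro i j
    split_ifs with h
    · subst h
      exact coordOn_basisWedge_self (Fin.snoc_injective_iff.mpr ⟨ha.injective, i.2⟩)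
    · refine coordOn_basisWedge_of_notMem_range (Fin.last d) ?_
      rw [Fin.snoc_last, Fin.range_snoc, Set.mem_insert_iff, not_or]
      exact ⟨fun e => h (Subtype.ext (hb.injective e)), i.2⟩
  · intro i j
    split_ifs with h
    · subst h
      exact coordOn_basisWedge_self (hb.injective.comp Fin.succAbove_right_injective)
    · obtain ⟨l, hl⟩ := hmem i.1 j.1 (fun e => h (Subtype.ext e))
      refine coordOn_basisWedge_of_notMem_range l ?_
      rintro ⟨m, hm⟩
      exact Fin.succAbove_ne j.1 m (hb.injective (hm.trans hl))
  · intro i j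
    refine coordOn_basisWedge_of_notMem_range s.castSucc ?_
    rw [Fin.snoc_castSucc]
    exact hs' j
  · intro i j
    refine coordOn_basisWedge_of_notMem_range' s.castSucc ?_
    rw [Fin.snoc_castSucc]
    exact hs' i

end
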